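/- (Block monotone Jacobi method.) Assume the quasimonotone assumptions hold for ordered upper and lower solutions Ũ, Û of the nonlinear difference scheme. Let {Ū⁽ⁿ⁾} and {U̲⁽ⁿ⁾} be sequences of mesh vector functions generated by the block Jacobi iteration with Ū⁽⁰⁾ = Ũ and U̲⁽⁰⁾ = Û. Then for all n ≥ 1 and all mesh points, U̲_α⁽ⁿ⁻¹⁾ ≤ U̲_α⁽ⁿ⁾ ≤ Ū_α⁽ⁿ⁾ ≤ Ū_α⁽ⁿ⁻¹⁾ for α = 1,2; the pointwise limits Ū_α = lim_{n→∞} Ū_α⁽ⁿ⁾ and U̲_α = lim_{n→∞} U̲_α⁽ⁿ⁾ exist; Ū = (Ū₁,Ū₂) and U̲ = (U̲₁,U̲₂) are solutions of the nonlinear difference scheme with U̲ ≤ Ū; and every solution S = (S₁,S₂) of the nonlinear difference scheme lying in the sector ⟨Û,Ũ⟩ satisfies U̲_α ≤ S_α ≤ Ū_α at every mesh point for α = 1,2. -/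

import Mathlib

namespace BlockMonotone

/-- A rectangular mesh on the unit square with `Nx, Ny ≥ 2` subdivisions. -/
structure Mesh where
  Nx : ℕ
  Ny : ℕ
  hNx : 2 ≤ Nx
  hNy : 2 ≤ Ny

namespace Mesh

variable (M : Mesh)

/-- Mesh spacing in the x-direction. -/
noncomputable def hx : ℝ := 1 / (M.Nx : ℝ)

/-- Mesh spacing in the y-direction. -/
noncomputable def hy : ℝ := 1 / (M.Ny : ℝ)

/-- `(i,j)` is a mesh point. -/
def IsMeshPt (i j : ℕ) : Prop := i ≤ M.Nx ∧ j ≤ M.Ny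

/-- `(i,j)` is an interior mesh point. -/
def IsInterior (i j : ℕ) : Prop := 1 ≤ i ∧ i ≤ M.Nx - 1 ∧ 1 ≤ j ∧ j ≤ M.Ny - 1

/-- `(i,j)` is a boundary mesh point. -/
def IsBoundary (i j : ℕ) : Prop := M.IsMeshPt i j ∧ ¬ M.IsInterior i j

/-- Coefficient `l_α(i,j) = ε/hx² + v(i,j)/hx`. -/
noncomputable def lC (ε : ℝ) (v : ℕ → ℕ → ℝ) (i j : ℕ) : ℝ := ε / M.hx ^ 2 + v i j / M.hx

/-- Coefficient `r_α(i,j) = ε/hx²`. -/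
noncomputable def rC (ε : ℝ) : ℝ := ε / M.hx ^ 2

/-- Coefficient `b_α(i,j) = ε/hy² + v(i,j)/hy`. -/
noncomputable def bC (ε : ℝ) (v : ℕ → ℕ → ℝ) (i j : ℕ) : ℝ := ε / M.hy ^ 2 + v i j / M.hy

/-- Coefficient `t_α(i,j) = ε/hy²`. -/
noncomputable def tC (ε : ℝ) : ℝ := ε / M.hy ^ 2

/-- Coefficient `d_α(i,j) = l + r + b + t`. -/
noncomputable def dC (ε : ℝ) (v : ℕ → ℕ → ℝ) (i j : ℕ) : ℝ :=
  M.lC ε v i j + M.rC ε + M.bC ε v i j + M.tC ε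

/-- The discrete operator `𝓛 U(i,j)` at interior points. -/
noncomputable def discL (ε : ℝ) (v : ℕ → ℕ → ℝ) (U : ℕ → ℕ → ℝ) (i j : ℕ) : ℝ :=
  M.dC ε v i j * U i j - M.lC ε v i j * U (i - 1) j - M.rC ε * U (i + 1) j
    - M.bC ε v i j * U i (j - 1) - M.tC ε * U i (j + 1)

end Mesh

/-- Partial derivative of a two-variable real function in its first variable. -/
noncomputable def p1 (f : ℝ → ℝ → ℝ) (u₁ u₂ : ℝ) : ℝ := deriv (fun x => f x u₂) u₁

/-- Partial derivative of a two-variable real function in its second variable. -/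
noncomputable def p2 (f : ℝ → ℝ → ℝ) (u₁ u₂ : ℝ) : ℝ := deriv (fun y => f u₁ y) u₂

end BlockMonotone

open BlockMonotone

namespace BlockMonotone

open Filter Topology

/-- A two-variable `C¹` function whose partial derivatives on a box are at most `c` and `0`
grows at most by `c` times the increment of its first argument. -/
lemma sub_le_mul_sub_of_partial_le {h : ℝ → ℝ → ℝ} (hh : ContDiff ℝ 1 fun p : ℝ × ℝ => h p.1 p.2)
    {c a₁ b₁ a₂ b₂ : ℝ}
    (h1 : ∀ x y, a₁ ≤ x → x ≤ b₁ → a₂ ≤ y → y ≤ b₂ → p1 h x y ≤ c)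
    (h2 : ∀ x y, a₁ ≤ x → x ≤ b₁ → a₂ ≤ y → y ≤ b₂ → p2 h x y ≤ 0)
    {x x' y y' : ℝ} (hx : a₁ ≤ x) (hxx : x ≤ x') (hx' : x' ≤ b₁)
    (hy : a₂ ≤ y) (hyy : y ≤ y') (hy' : y' ≤ b₂) :
    h x' y' - h x y ≤ c * (x' - x) := by
  have hd : Differentiable ℝ fun p : ℝ × ℝ => h p.1 p.2 := hh.differentiable one_ne_zero
  have hdx : Differentiable ℝ fun s => h s y := fun s =>
    (hd (s, y)).comp s (f := fun s : ℝ => (s, y)) (by fun_prop)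
  have hdy : Differentiable ℝ fun s => h x' s := fun s =>
    (hd (x', s)).comp s (f := fun s : ℝ => (x', s)) (by fun_prop)
  have e1 : h x' y - h x y ≤ c * (x' - x) :=
    (convex_Icc a₁ b₁).image_sub_le_mul_sub_of_deriv_le hdx.continuous.continuousOn
      hdx.differentiableOn
      (fun s hs => h1 s y (interior_subset hs).1 (interior_subset hs).2 hy (hyy.trans hy'))
      x ⟨hx, hxx.trans hx'⟩ x' ⟨hx.trans hxx, hx'⟩ hxx
  have e2 : h x' y' - h x' y ≤ 0 * (y' - y) :=
    (convex_Icc a₂ b₂).image_sub_le_mul_sub_of_deriv_le hdy.continuous.continuousOn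
      hdy.differentiableOn
      (fun s hs => h2 x' s (hx.trans hxx) hx' (interior_subset hs).1 (interior_subset hs).2)
      y ⟨hy, hyy.trans hy'⟩ y' ⟨hy.trans hyy, hy'⟩ hyy
  linarith

namespace Mesh

variable (M : Mesh)

/-- Pointwise order of mesh vector functions. -/
def MeshLE (V W : Fin 2 → ℕ → ℕ → ℝ) : Prop := ∀ a i j, M.IsMeshPt i j → V a i j ≤ W a i j

/-- The implicit part of the block Jacobi iteration. -/
noncomputable def lineOp (ε : ℝ) (v c W : ℕ → ℕ → ℝ) (i j : ℕ) : ℝ :=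
  M.dC ε v i j * W i j - M.bC ε v i j * W i (j - 1) - M.tC ε * W i (j + 1) + c i j * W i j

/-- The explicit part of the block Jacobi iteration. -/
noncomputable def jacobiRhs (ε : Fin 2 → ℝ) (v c : Fin 2 → ℕ → ℕ → ℝ)
    (f : Fin 2 → ℕ → ℕ → ℝ → ℝ → ℝ) (V : Fin 2 → ℕ → ℕ → ℝ) (a : Fin 2) (i j : ℕ) : ℝ :=
  M.lC (ε a) (v a) i j * V a (i - 1) j + M.rC (ε a) * V a (i + 1) j
    + c a i j * V a i j - f a i j (V 0 i j) (V 1 i j)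

lemma hx_pos : 0 < M.hx := by
  have := M.hNx
  unfold hx
  positivity

lemma hy_pos : 0 < M.hy := by
  have := M.hNy
  unfold hy
  positivity

lemma rC_pos {ε : ℝ} (hε : 0 < ε) : 0 < M.rC ε := div_pos hε (pow_pos M.hx_pos 2)

lemma tC_pos {ε : ℝ} (hε : 0 < ε) : 0 < M.tC ε := div_pos hε (pow_pos M.hy_pos 2)

lemma lC_pos {ε : ℝ} (hε : 0 < ε) {v : ℕ → ℕ → ℝ} {i j : ℕ} (hv : 0 ≤ v i j) :
    0 < M.lC ε v i j :=
  add_pos_of_pos_of_nonneg (M.rC_pos hε) (div_nonneg hv M.hx_pos.le)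

lemma bC_pos {ε : ℝ} (hε : 0 < ε) {v : ℕ → ℕ → ℝ} {i j : ℕ} (hv : 0 ≤ v i j) :
    0 < M.bC ε v i j :=
  add_pos_of_pos_of_nonneg (M.tC_pos hε) (div_nonneg hv M.hy_pos.le)

variable {M}

lemma MeshLE.trans {U V W : Fin 2 → ℕ → ℕ → ℝ} (h : M.MeshLE U V) (h' : M.MeshLE V W) :
    M.MeshLE U W := fun a i j hm => (h a i j hm).trans (h' a i j hm)

lemma MeshLE.rfl {U : Fin 2 → ℕ → ℕ → ℝ} : M.MeshLE U U := fun _ _ _ _ => le_rfl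

lemma IsInterior.neighbors {i j : ℕ} (h : M.IsInterior i j) :
    M.IsMeshPt i j ∧ M.IsMeshPt (i - 1) j ∧ M.IsMeshPt (i + 1) j ∧ M.IsMeshPt i (j - 1) ∧
      M.IsMeshPt i (j + 1) := by
  unfold IsInterior at h
  unfold IsMeshPt
  omega

/-- Discrete maximum principle for the line operator. -/
lemma nonneg_of_lineOp_nonneg {ε : ℝ} (hε : 0 < ε) {v c w : ℕ → ℕ → ℝ}
    (hv : ∀ i j, M.IsMeshPt i j → 0 ≤ v i j) (hc : ∀ i j, M.IsMeshPt i j → 0 ≤ c i j)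
    (hw : ∀ i j, M.IsInterior i j → 0 ≤ M.lineOp ε v c w i j)
    (hbd : ∀ i j, M.IsBoundary i j → 0 ≤ w i j) {i j : ℕ} (hij : M.IsMeshPt i j) :
    0 ≤ w i j := by
  obtain ⟨k, hk, hmin⟩ := (Finset.range (M.Ny + 1)).exists_min_image (w i) ⟨0, by simp⟩
  rw [Finset.mem_range] at hk
  have hle : ∀ s, M.IsMeshPt i s → w i k ≤ w i s := fun s hs =>
    hmin s (Finset.mem_range.2 (Nat.lt_succ_of_le hs.2))
  refine le_trans ?_ (hle j hij)
  by_cases hint : M.IsInterior i k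
  · by_contra! hneg
    obtain ⟨hm, -, -, hb, ht⟩ := hint.neighbors
    have h0 := hw i k hint
    have hl := M.lC_pos hε (hv i k hm)
    have hr := M.rC_pos hε
    have e1 := mul_le_mul_of_nonneg_left (hle _ hb) (M.bC_pos hε (hv i k hm)).le
    have e2 := mul_le_mul_of_nonneg_left (hle _ ht) (M.tC_pos hε).le
    have e3 := mul_nonpos_of_nonneg_of_nonpos (hc i k hm) hneg.le
    have e4 := mul_neg_of_pos_of_neg (add_pos hl hr) hneg
    unfold lineOp dC at h0
    linarith
  · exact hbd i k ⟨⟨hij.1, Nat.le_of_lt_succ hk⟩, hint⟩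

section Comparison

variable {ε : Fin 2 → ℝ} {v c : Fin 2 → ℕ → ℕ → ℝ} {f : Fin 2 → ℕ → ℕ → ℝ → ℝ → ℝ}

lemma discL_add_eq (V : Fin 2 → ℕ → ℕ → ℝ) (a : Fin 2) (i j : ℕ) :
    M.discL (ε a) (v a) (V a) i j + f a i j (V 0 i j) (V 1 i j)
      = M.lineOp (ε a) (v a) (c a) (V a) i j - M.jacobiRhs ε v c f V a i j := by
  unfold discL lineOp jacobiRhs
  ring

/-- The explicit part of the iteration is monotone on the sector. -/
lemma jacobiRhs_mono (hε : ∀ a, 0 < ε a) (hv : ∀ a i j, M.IsMeshPt i j → 0 ≤ v a i j)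
    (hf : ∀ a i j, ContDiff ℝ 1 (fun p : ℝ × ℝ => f a i j p.1 p.2))
    {A B : Fin 2 → ℕ → ℕ → ℝ}
    (hq1 : ∀ i j, M.IsMeshPt i j → ∀ u₁ u₂,
      A 0 i j ≤ u₁ → u₁ ≤ B 0 i j → A 1 i j ≤ u₂ → u₂ ≤ B 1 i j →
      p1 (f 0 i j) u₁ u₂ ≤ c 0 i j ∧ p2 (f 1 i j) u₁ u₂ ≤ c 1 i j)
    (hq2 : ∀ i j, M.IsMeshPt i j → ∀ u₁ u₂,
      A 0 i j ≤ u₁ → u₁ ≤ B 0 i j → A 1 i j ≤ u₂ → u₂ ≤ B 1 i j →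
      p2 (f 0 i j) u₁ u₂ ≤ 0 ∧ p1 (f 1 i j) u₁ u₂ ≤ 0)
    {V W : Fin 2 → ℕ → ℕ → ℝ} (hA : M.MeshLE A V) (hVW : M.MeshLE V W) (hB : M.MeshLE W B)
    (a : Fin 2) {i j : ℕ} (hij : M.IsInterior i j) :
    M.jacobiRhs ε v c f V a i j ≤ M.jacobiRhs ε v c f W a i j := by
  obtain ⟨hm, hl, hr, -, -⟩ := hij.neighbors
  have key : f a i j (W 0 i j) (W 1 i j) - f a i j (V 0 i j) (V 1 i j)
      ≤ c a i j * (W a i j - V a i j) := by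
    fin_cases a
    · exact sub_le_mul_sub_of_partial_le (hf 0 i j)
        (fun x y h₁ h₂ h₃ h₄ => (hq1 i j hm x y h₁ h₂ h₃ h₄).1)
        (fun x y h₁ h₂ h₃ h₄ => (hq2 i j hm x y h₁ h₂ h₃ h₄).1)
        (hA 0 i j hm) (hVW 0 i j hm) (hB 0 i j hm) (hA 1 i j hm) (hVW 1 i j hm) (hB 1 i j hm)
    · exact sub_le_mul_sub_of_partial_le (h := fun y x => f 1 i j x y)
        ((hf 1 i j).comp (contDiff_snd.prodMk contDiff_fst))
        (fun y x h₃ h₄ h₁ h₂ => (hq1 i j hm x y h₁ h₂ h₃ h₄).2)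
        (fun y x h₃ h₄ h₁ h₂ => (hq2 i j hm x y h₁ h₂ h₃ h₄).2)
        (hA 1 i j hm) (hVW 1 i j hm) (hB 1 i j hm) (hA 0 i j hm) (hVW 0 i j hm) (hB 0 i j hm)
  have e1 := mul_le_mul_of_nonneg_left (hVW a _ _ hl) (M.lC_pos (hε a) (hv a i j hm)).le
  have e2 := mul_le_mul_of_nonneg_left (hVW a _ _ hr) (M.rC_pos (hε a)).le
  unfold jacobiRhs
  linarith

/-- Comparison principle for the line operator. -/
lemma meshLE_of_lineOp_le (hε : ∀ a, 0 < ε a) (hv : ∀ a i j, M.IsMeshPt i j → 0 ≤ v a i j)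
    (hc : ∀ a i j, M.IsMeshPt i j → 0 ≤ c a i j) {V W : Fin 2 → ℕ → ℕ → ℝ}
    (h : ∀ a i j, M.IsInterior i j →
      M.lineOp (ε a) (v a) (c a) (V a) i j ≤ M.lineOp (ε a) (v a) (c a) (W a) i j)
    (hbd : ∀ a i j, M.IsBoundary i j → V a i j ≤ W a i j) : M.MeshLE V W := by
  intro a i j hij
  refine sub_nonneg.1 (nonneg_of_lineOp_nonneg (w := fun i j => W a i j - V a i j) (hε a) (hv a)
    (hc a) (fun i j hij => ?_) (fun i j hij => sub_nonneg.2 (hbd a i j hij)) hij)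
  have := h a i j hij
  unfold lineOp at this ⊢
  linarith

/-- A pointwise limit of block Jacobi iterates solves the difference scheme. -/
lemma discL_add_eq_zero_of_tendsto (hf : ∀ a i j, Continuous fun p : ℝ × ℝ => f a i j p.1 p.2)
    {U : ℕ → Fin 2 → ℕ → ℕ → ℝ} {L : Fin 2 → ℕ → ℕ → ℝ}
    (hstep : ∀ n a i j, M.IsInterior i j →
      M.lineOp (ε a) (v a) (c a) (U (n + 1) a) i j = M.jacobiRhs ε v c f (U n) a i j)
    (hlim : ∀ a i j, M.IsMeshPt i j → Tendsto (fun n => U n a i j) atTop (𝓝 (L a i j)))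
    (a : Fin 2) {i j : ℕ} (hij : M.IsInterior i j) :
    M.discL (ε a) (v a) (L a) i j + f a i j (L 0 i j) (L 1 i j) = 0 := by
  obtain ⟨hm, hl, hr, hb, ht⟩ := hij.neighbors
  have hlim' : ∀ a i j, M.IsMeshPt i j →
      Tendsto (fun n => U (n + 1) a i j) atTop (𝓝 (L a i j)) := fun a i j h =>
    (hlim a i j h).comp (tendsto_add_atTop_nat 1)
  have h1 : Tendsto (fun n => M.lineOp (ε a) (v a) (c a) (U (n + 1) a) i j) atTop
      (𝓝 (M.lineOp (ε a) (v a) (c a) (L a) i j)) :=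
    ((((hlim' a i j hm).const_mul _).sub ((hlim' a _ _ hb).const_mul _)).sub
      ((hlim' a _ _ ht).const_mul _)).add ((hlim' a i j hm).const_mul _)
  have h2 : Tendsto (fun n => M.jacobiRhs ε v c f (U n) a i j) atTop
      (𝓝 (M.jacobiRhs ε v c f L a i j)) :=
    ((((hlim a _ _ hl).const_mul _).add ((hlim a _ _ hr).const_mul _)).add
      ((hlim a i j hm).const_mul _)).sub
      (((hf a i j).tendsto (L 0 i j, L 1 i j)).comp
        ((hlim 0 i j hm).prodMk_nhds (hlim 1 i j hm)))
  rw [discL_add_eq (c := c), sub_eq_zero]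
  exact tendsto_nhds_unique h1 (h2.congr fun n => (hstep n a i j hij).symm)

end Comparison

end Mesh

end BlockMonotone

/-- Block monotone Jacobi method: monotone convergence of the upper and lower
sequences to maximal and minimal solutions of the nonlinear difference scheme. -/
theorem block_monotone_jacobi (M : Mesh)
    (ε : Fin 2 → ℝ) (hε : ∀ a, 0 < ε a)
    (v : Fin 2 → ℕ → ℕ → ℝ) (hv : ∀ a i j, M.IsMeshPt i j → 0 ≤ v a i j)
    (f : Fin 2 → ℕ → ℕ → ℝ → ℝ → ℝ) (g : Fin 2 → ℕ → ℕ → ℝ)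
    (Utilde Uhat : Fin 2 → ℕ → ℕ → ℝ)
    (c : Fin 2 → ℕ → ℕ → ℝ)
    (hc : ∀ a i j, M.IsMeshPt i j → 0 ≤ c a i j)
    (hf : ∀ a i j, ContDiff ℝ 1 (fun p : ℝ × ℝ => f a i j p.1 p.2))
    (hq1 : ∀ i j, M.IsMeshPt i j → ∀ u₁ u₂,
      Uhat 0 i j ≤ u₁ → u₁ ≤ Utilde 0 i j → Uhat 1 i j ≤ u₂ → u₂ ≤ Utilde 1 i j →
      p1 (f 0 i j) u₁ u₂ ≤ c 0 i j ∧ p2 (f 1 i j) u₁ u₂ ≤ c 1 i j)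
    (hq2 : ∀ i j, M.IsMeshPt i j → ∀ u₁ u₂,
      Uhat 0 i j ≤ u₁ → u₁ ≤ Utilde 0 i j → Uhat 1 i j ≤ u₂ → u₂ ≤ Utilde 1 i j →
      p2 (f 0 i j) u₁ u₂ ≤ 0 ∧ p1 (f 1 i j) u₁ u₂ ≤ 0)
    (hord : ∀ a i j, M.IsMeshPt i j → Uhat a i j ≤ Utilde a i j)
    (hupper : ∀ a i j, M.IsInterior i j →
      0 ≤ M.discL (ε a) (v a) (Utilde a) i j + f a i j (Utilde 0 i j) (Utilde 1 i j))
    (hlower : ∀ a i j, M.IsInterior i j →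
      M.discL (ε a) (v a) (Uhat a) i j + f a i j (Uhat 0 i j) (Uhat 1 i j) ≤ 0)
    (hbd : ∀ a i j, M.IsBoundary i j → Uhat a i j ≤ g a i j ∧ g a i j ≤ Utilde a i j)
    (Ub Ul : ℕ → Fin 2 → ℕ → ℕ → ℝ)
    (hUb0 : ∀ a i j, Ub 0 a i j = Utilde a i j)
    (hUl0 : ∀ a i j, Ul 0 a i j = Uhat a i j)
    (hubstep : ∀ n, 1 ≤ n → ∀ a i j, M.IsInterior i j →
      M.dC (ε a) (v a) i j * Ub n a i j - M.bC (ε a) (v a) i j * Ub n a i (j - 1)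
          - M.tC (ε a) * Ub n a i (j + 1) + c a i j * Ub n a i j
        = M.lC (ε a) (v a) i j * Ub (n - 1) a (i - 1) j + M.rC (ε a) * Ub (n - 1) a (i + 1) j
          + c a i j * Ub (n - 1) a i j
          - f a i j (Ub (n - 1) 0 i j) (Ub (n - 1) 1 i j))
    (hubbd : ∀ n, 1 ≤ n → ∀ a i j, M.IsBoundary i j → Ub n a i j = g a i j)
    (hlostep : ∀ n, 1 ≤ n → ∀ a i j, M.IsInterior i j →
      M.dC (ε a) (v a) i j * Ul n a i j - M.bC (ε a) (v a) i j * Ul n a i (j - 1)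
          - M.tC (ε a) * Ul n a i (j + 1) + c a i j * Ul n a i j
        = M.lC (ε a) (v a) i j * Ul (n - 1) a (i - 1) j + M.rC (ε a) * Ul (n - 1) a (i + 1) j
          + c a i j * Ul (n - 1) a i j
          - f a i j (Ul (n - 1) 0 i j) (Ul (n - 1) 1 i j))
    (hlobd : ∀ n, 1 ≤ n → ∀ a i j, M.IsBoundary i j → Ul n a i j = g a i j) :
    (∀ n, 1 ≤ n → ∀ a i j, M.IsMeshPt i j →
      Ul (n - 1) a i j ≤ Ul n a i j ∧ Ul n a i j ≤ Ub n a i j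
        ∧ Ub n a i j ≤ Ub (n - 1) a i j)
    ∧ ∃ Ubar Ulow : Fin 2 → ℕ → ℕ → ℝ,
      (∀ a i j, M.IsMeshPt i j →
        Filter.Tendsto (fun n => Ub n a i j) Filter.atTop (nhds (Ubar a i j)))
      ∧ (∀ a i j, M.IsMeshPt i j →
        Filter.Tendsto (fun n => Ul n a i j) Filter.atTop (nhds (Ulow a i j)))
      ∧ (∀ a i j, M.IsInterior i j →
        M.discL (ε a) (v a) (Ubar a) i j + f a i j (Ubar 0 i j) (Ubar 1 i j) = 0)
      ∧ (∀ a i j, M.IsBoundary i j → Ubar a i j = g a i j)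
      ∧ (∀ a i j, M.IsInterior i j →
        M.discL (ε a) (v a) (Ulow a) i j + f a i j (Ulow 0 i j) (Ulow 1 i j) = 0)
      ∧ (∀ a i j, M.IsBoundary i j → Ulow a i j = g a i j)
      ∧ (∀ a i j, M.IsMeshPt i j → Ulow a i j ≤ Ubar a i j)
      ∧ (∀ S : Fin 2 → ℕ → ℕ → ℝ,
          (∀ a i j, M.IsInterior i j →
            M.discL (ε a) (v a) (S a) i j + f a i j (S 0 i j) (S 1 i j) = 0) →
          (∀ a i j, M.IsBoundary i j → S a i j = g a i j) →
          (∀ a i j, M.IsMeshPt i j → Uhat a i j ≤ S a i j ∧ S a i j ≤ Utilde a i j) →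
          ∀ a i j, M.IsMeshPt i j → Ulow a i j ≤ S a i j ∧ S a i j ≤ Ubar a i j) := by
  have hub : ∀ n a i j, M.IsInterior i j →
      M.lineOp (ε a) (v a) (c a) (Ub (n + 1) a) i j = M.jacobiRhs ε v c f (Ub n) a i j :=
    fun n => hubstep (n + 1) (by omega)
  have hlo : ∀ n a i j, M.IsInterior i j →
      M.lineOp (ε a) (v a) (c a) (Ul (n + 1) a) i j = M.jacobiRhs ε v c f (Ul n) a i j :=
    fun n => hlostep (n + 1) (by omega)
  have hubg : ∀ n a i j, M.IsBoundary i j → Ub (n + 1) a i j = g a i j :=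
    fun n => hubbd (n + 1) (by omega)
  have hlog : ∀ n a i j, M.IsBoundary i j → Ul (n + 1) a i j = g a i j :=
    fun n => hlobd (n + 1) (by omega)
  obtain rfl : Ub 0 = Utilde := by ext a i j; exact hUb0 a i j
  obtain rfl : Ul 0 = Uhat := by ext a i j; exact hUl0 a i j
  have step : ∀ V V' W W' : Fin 2 → ℕ → ℕ → ℝ,
      M.MeshLE (Ul 0) V → M.MeshLE V V' → M.MeshLE V' (Ub 0) →
      (∀ a i j, M.IsInterior i j →
        M.lineOp (ε a) (v a) (c a) (W a) i j ≤ M.jacobiRhs ε v c f V a i j) →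
      (∀ a i j, M.IsInterior i j →
        M.jacobiRhs ε v c f V' a i j ≤ M.lineOp (ε a) (v a) (c a) (W' a) i j) →
      (∀ a i j, M.IsBoundary i j → W a i j ≤ W' a i j) → M.MeshLE W W' :=
    fun V V' W W' h1 h2 h3 h4 h5 h6 => Mesh.meshLE_of_lineOp_le hε hv hc
      (fun a i j hij => (h4 a i j hij).trans
        ((Mesh.jacobiRhs_mono hε hv hf hq1 hq2 h1 h2 h3 a hij).trans (h5 a i j hij))) h6
  have main : ∀ n, M.MeshLE (Ul 0) (Ul n) ∧ M.MeshLE (Ul n) (Ul (n + 1)) ∧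
      M.MeshLE (Ul n) (Ub n) ∧ M.MeshLE (Ub (n + 1)) (Ub n) ∧ M.MeshLE (Ub n) (Ub 0) := by
    intro n
    induction n with
    | zero =>
      refine ⟨.rfl, ?_, hord, ?_, .rfl⟩
      · refine step (Ul 0) (Ul 0) _ _ .rfl .rfl hord (fun a i j h => ?_)
          (fun a i j h => (hlo 0 a i j h).ge)
          (fun a i j h => (hbd a i j h).1.trans (hlog 0 a i j h).ge)
        have := hlower a i j h
        rw [Mesh.discL_add_eq (c := c)] at this
        linarith
      · refine step (Ub 0) (Ub 0) _ _ hord .rfl .rfl (fun a i j h => (hub 0 a i j h).le)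
          (fun a i j h => ?_) (fun a i j h => (hubg 0 a i j h).le.trans (hbd a i j h).2)
        have := hupper a i j h
        rw [Mesh.discL_add_eq (c := c)] at this
        linarith
    | succ n ih =>
      obtain ⟨h1, h2, h3, h4, h5⟩ := ih
      have h12 := h1.trans h2
      have h45 := h4.trans h5
      have h : M.MeshLE (Ul (n + 1)) (Ub (n + 1)) :=
        step _ _ _ _ h1 h3 h5 (fun a i j h => (hlo n a i j h).le)
          (fun a i j h => (hub n a i j h).ge)
          (fun a i j h => ((hlog n a i j h).trans (hubg n a i j h).symm).le)
      refine ⟨h12, ?_, h, ?_, h45⟩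
      · exact step _ _ _ _ h1 h2 (h.trans h45) (fun a i j h => (hlo n a i j h).le)
          (fun a i j h => (hlo (n + 1) a i j h).ge)
          (fun a i j h => ((hlog n a i j h).trans (hlog (n + 1) a i j h).symm).le)
      · exact step _ _ _ _ (h12.trans h) h4 h5 (fun a i j h => (hub (n + 1) a i j h).le)
          (fun a i j h => (hub n a i j h).ge)
          (fun a i j h => ((hubg (n + 1) a i j h).trans (hubg n a i j h).symm).le)
  have hbdm : ∀ {i j}, M.IsBoundary i j → M.IsMeshPt i j := fun h => h.1
  have hlimb : ∀ a i j, M.IsMeshPt i j →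
      Filter.Tendsto (fun n => Ub n a i j) Filter.atTop (nhds (⨅ n, Ub n a i j)) :=
    fun a i j h => tendsto_atTop_ciInf (antitone_nat_of_succ_le fun n => (main n).2.2.2.1 a i j h)
      ⟨Ul 0 a i j, by
        rintro _ ⟨n, rfl⟩
        exact ((main n).1.trans (main n).2.2.1) a i j h⟩
  have hliml : ∀ a i j, M.IsMeshPt i j →
      Filter.Tendsto (fun n => Ul n a i j) Filter.atTop (nhds (⨆ n, Ul n a i j)) :=
    fun a i j h => tendsto_atTop_ciSup (monotone_nat_of_le_succ fun n => (main n).2.1 a i j h)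
      ⟨Ub 0 a i j, by
        rintro _ ⟨n, rfl⟩
        exact ((main n).2.2.1.trans (main n).2.2.2.2) a i j h⟩
  have hcont := fun a i j => (hf a i j).continuous
  refine ⟨fun n hn a i j h => ?_, fun a i j => ⨅ n, Ub n a i j, fun a i j => ⨆ n, Ul n a i j,
    hlimb, hliml, fun a i j h => Mesh.discL_add_eq_zero_of_tendsto hcont hub hlimb a h,
    fun a i j h => ?_, fun a i j h => Mesh.discL_add_eq_zero_of_tendsto hcont hlo hliml a h,
    fun a i j h => ?_,
    fun a i j h => le_of_tendsto_of_tendsto' (hliml a i j h) (hlimb a i j h)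
      fun n => (main n).2.2.1 a i j h, fun S hS hSg hSs => ?_⟩
  · obtain ⟨n, rfl⟩ := Nat.exists_eq_add_of_le' hn
    exact ⟨(main n).2.1 a i j h, (main (n + 1)).2.2.1 a i j h, (main n).2.2.2.1 a i j h⟩
  · refine tendsto_nhds_unique ((hlimb a i j (hbdm h)).comp (Filter.tendsto_add_atTop_nat 1)) ?_
    exact tendsto_const_nhds.congr fun n => (hubg n a i j h).symm
  · refine tendsto_nhds_unique ((hliml a i j (hbdm h)).comp (Filter.tendsto_add_atTop_nat 1)) ?_
    exact tendsto_const_nhds.congr fun n => (hlog n a i j h).symm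
  · have hSeq : ∀ a i j, M.IsInterior i j →
        M.lineOp (ε a) (v a) (c a) (S a) i j = M.jacobiRhs ε v c f S a i j := fun a i j h => by
      have := hS a i j h
      rwa [Mesh.discL_add_eq (c := c), sub_eq_zero] at this
    have hlS : M.MeshLE (Ul 0) S := fun a i j h => (hSs a i j h).1
    have hSu : M.MeshLE S (Ub 0) := fun a i j h => (hSs a i j h).2
    have hSn : ∀ n, M.MeshLE (Ul n) S ∧ M.MeshLE S (Ub n) := by
      intro n
      induction n with
      | zero => exact ⟨hlS, hSu⟩
      | succ n ih =>
        exact ⟨step _ _ _ _ (main n).1 ih.1 hSu (fun a i j h => (hlo n a i j h).le)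
            (fun a i j h => (hSeq a i j h).ge)
            (fun a i j h => ((hlog n a i j h).trans (hSg a i j h).symm).le),
          step _ _ _ _ hlS ih.2 (main n).2.2.2.2 (fun a i j h => (hSeq a i j h).le)
            (fun a i j h => (hub n a i j h).ge)
            (fun a i j h => ((hSg a i j h).trans (hubg n a i j h).symm).le)⟩
    exact fun a i j h => ⟨le_of_tendsto' (hliml a i j h) fun n => (hSn n).1 a i j h,
      ge_of_tendsto' (hlimb a i j h) fun n => (hSn n).2 a i j h⟩
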